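/- Assume (A3). If M and L are circles with p ∉ M, p ∉ L, and pM = pL (the unique point of M parallel to p coincides with the unique point of L parallel to p), then the lines M ∖ p̄ and L ∖ p̄ of SA(p,K) are parallel. -/

import Mathlib

/-- A Laguerre plane: points, circles, and a parallelity relation. -/
structure LaguerrePlane (P : Type*) where
  Circles : Set (Set P)
  Par : P → P → Prop
  par_equiv : Equivalence Par
  joinCircle : ∀ a b c : P, ¬ Par a b → ¬ Par b c → ¬ Par a c →
    ∃! C, C ∈ Circles ∧ a ∈ C ∧ b ∈ C ∧ c ∈ C
  touching : ∀ K ∈ Circles, ∀ p ∈ K, ∀ q, q ∉ K → ¬ Par p q →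
    ∃! C, C ∈ Circles ∧ q ∈ C ∧ K ∩ C = {p}
  parPoint : ∀ (x : P), ∀ K ∈ Circles, ∃! q, Par x q ∧ q ∈ K
  nontriv : ∃ C ∈ Circles,
    (∃ a b c : P, a ∈ C ∧ b ∈ C ∧ c ∈ C ∧ a ≠ b ∧ b ≠ c ∧ a ≠ c) ∧ C ≠ Set.univ

namespace LaguerrePlane

variable {P : Type*}

/-- The generator (parallel class) of a point. -/
def gen (L : LaguerrePlane P) (p : P) : Set P := {q | L.Par p q}

/-- The pencil ⟨p,K⟩: the circle K together with all circles tangent to K at p. -/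
def pencil (L : LaguerrePlane P) (p : P) (K : Set P) : Set (Set P) :=
  insert K {M | M ∈ L.Circles ∧ M ∩ K = {p}}

/-- An automorphism of a Laguerre plane: a bijection of the points mapping
circles onto circles and preserving parallelity. -/
def IsAut (L : LaguerrePlane P) (σ : Equiv.Perm P) : Prop :=
  (∀ C, C ∈ L.Circles ↔ ⇑σ '' C ∈ L.Circles) ∧
  (∀ x y, L.Par x y ↔ L.Par (σ x) (σ y))

/-- The line x ⊔ y of the residual plane SA(p,K):
{x} together with the orbit of y under the stabilizer of x in Δ. -/
def line (Δ : Subgroup (Equiv.Perm P)) (x y : P) : Set P :=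
  {x} ∪ {z | ∃ σ ∈ Δ, σ x = x ∧ σ y = z}

/-- Parallelity of lines of the residual plane SA(p,K). -/
def LinePar (Δ : Subgroup (Equiv.Perm P)) (A B : Set P) : Prop :=
  ∃ σ ∈ Δ, ⇑σ '' A = B

end LaguerrePlane

open LaguerrePlane

namespace LaguerrePlane

variable {P : Type*} (L : LaguerrePlane P) {p : P} {K : Set P}

theorem circle_of_mem_pencil (hK : K ∈ L.Circles) {M : Set P} (hM : M ∈ L.pencil p K) :
    M ∈ L.Circles := by
  rcases hM with rfl | hM
  exacts [hK, hM.1]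

theorem mem_of_mem_pencil (hpK : p ∈ K) {M : Set P} (hM : M ∈ L.pencil p K) : p ∈ M := by
  rcases hM with rfl | hM
  · exact hpK
  · have h : p ∈ M ∩ K := hM.2 ▸ Set.mem_singleton p
    exact h.1

/-- Parallel points of a circle coincide. -/
theorem eq_of_par {C : Set P} (hC : C ∈ L.Circles) {x y : P} (hx : x ∈ C) (hy : y ∈ C)
    (h : L.Par x y) : x = y :=
  (L.parPoint x C hC).unique ⟨L.par_equiv.refl x, hx⟩ ⟨h, hy⟩

/-- A point not parallel to `p` lies on at most one circle of the pencil `⟨p, K⟩`. -/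
theorem pencil_unique (hK : K ∈ L.Circles) (hpK : p ∈ K) {A B : Set P}
    (hA : A ∈ L.pencil p K) (hB : B ∈ L.pencil p K) {w : P} (hw : ¬ L.Par p w)
    (hwA : w ∈ A) (hwB : w ∈ B) : A = B := by
  have hwp : w ≠ p := by
    rintro rfl
    exact hw (L.par_equiv.refl w)
  by_cases hwK : w ∈ K
  · have key : ∀ C ∈ L.pencil p K, w ∈ C → C = K := by
      rintro C (rfl | ⟨-, hC⟩) hwC
      · rfl
      · have h : w ∈ C ∩ K := ⟨hwC, hwK⟩
        rw [hC] at h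
        exact absurd h hwp
    rw [key A hA hwA, key B hB hwB]
  · have key : ∀ C ∈ L.pencil p K, w ∈ C → C ∈ L.Circles ∧ w ∈ C ∧ K ∩ C = {p} := by
      rintro C (rfl | ⟨hC, hCK⟩) hwC
      · exact absurd hwC hwK
      · exact ⟨hC, hwC, by rw [Set.inter_comm, hCK]⟩
    exact (L.touching K hK p hpK w hwK hw).unique (key A hA hwA) (key B hB hwB)

end LaguerrePlane

/-- assume (A3).  If M, N are circles avoiding p with pM = pL
(i.e. they have a common point parallel to p), then the lines M ∖ p̄ and N ∖ p̄
of SA(p,K) are parallel. -/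
theorem same_parallel_point_implies_parallel_lines
    {P : Type*} (L : LaguerrePlane P) (p : P) (K : Set P)
    (Δ : Subgroup (Equiv.Perm P))
    (hK : K ∈ L.Circles) (hpK : p ∈ K)
    (haut : ∀ σ ∈ Δ, L.IsAut σ)
    (hfix : ∀ σ ∈ Δ, ∀ q, L.Par p q → σ q = q)
    (hpen : ∀ σ ∈ Δ, ∀ M ∈ L.pencil p K, ⇑σ '' M ∈ L.pencil p K)
    (hA1 : ∀ x y : P, ¬ L.Par p x → ¬ L.Par p y → ∃ σ ∈ Δ, σ x = y)
    (hA2 : ∀ r ∈ K, r ≠ p → ∀ x ∈ K, x ≠ p → x ≠ r → ∀ y ∈ K, y ≠ p → y ≠ r →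
      ∃ σ ∈ Δ, σ r = r ∧ σ x = y)    (hA3 : ∀ M ∈ L.Circles, p ∉ M → ∃! N, N ∈ L.pencil p K ∧ ∃ z, M ∩ N = {z})    :
    ∀ M ∈ L.Circles, ∀ N ∈ L.Circles, p ∉ M → p ∉ N →
    (∃ q : P, L.Par p q ∧ q ∈ M ∧ q ∈ N) →
    LinePar Δ (M \ L.gen p) (N \ L.gen p) := by
  rintro M hM N hN hpM hpN ⟨q, hpq, hqM, hqN⟩
  obtain ⟨S, ⟨hS, z, hz⟩, -⟩ := hA3 M hM hpM
  obtain ⟨T, ⟨hT, w, hw⟩, -⟩ := hA3 N hN hpN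
  have hSC := L.circle_of_mem_pencil hK hS
  have hTC := L.circle_of_mem_pencil hK hT
  have hpS := L.mem_of_mem_pencil hpK hS
  have hpT := L.mem_of_mem_pencil hpK hT
  have hzm : z ∈ M ∩ S := hz ▸ Set.mem_singleton z
  have hwm : w ∈ N ∩ T := hw ▸ Set.mem_singleton w
  have hpz : ¬ L.Par p z := fun h => hpM (L.eq_of_par hSC hpS hzm.2 h ▸ hzm.1)
  have hpw : ¬ L.Par p w := fun h => hpN (L.eq_of_par hTC hpT hwm.2 h ▸ hwm.1)
  have hqT : q ∉ T := fun h => hpN (L.eq_of_par hTC hpT h hpq ▸ hqN)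
  have hwq : ¬ L.Par w q := fun h =>
    hpw (L.par_equiv.trans hpq (L.par_equiv.symm h))
  obtain ⟨σ, hσ, hσz⟩ := hA1 z w hpz hpw
  have hST : σ '' S = T := L.pencil_unique hK hpK (hpen σ hσ S hS) hT hpw
    ⟨z, hzm.2, hσz⟩ hwm.2
  have hMN : σ '' M = N := by
    refine (L.touching T hTC w hwm.2 q hqT hwq).unique
      ⟨((haut σ hσ).1 M).1 hM, ⟨q, hqM, hfix σ hσ q hpq⟩, ?_⟩
      ⟨hN, hqN, by rw [Set.inter_comm, hw]⟩
    rw [← hST, ← Set.image_inter σ.injective, Set.inter_comm, hz, Set.image_singleton, hσz]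
  have hgen : σ '' L.gen p = L.gen p := by
    have hfixOn : Set.EqOn σ id (L.gen p) := fun x hx => hfix σ hσ x hx
    rw [hfixOn.image_eq, Set.image_id]
  exact ⟨σ, hσ, by rw [Set.image_sdiff σ.injective, hMN, hgen]⟩
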